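/- Let Q be a poset, U ⊆ Q an upset, and D ⊆ Q a downset with U ∩ D ≠ ∅. Assume that either every pair of elements of U has a lower bound lying in U, or every pair of elements of D has an upper bound lying in D. Then Hom_Q(k[U], k[D]) is a one-dimensional k-vector space. -/

import Mathlib

/-- The component of the indicator module `k[S]` in degree `q`: the field `k`
(as the full submodule of itself) if `q ∈ S`, and `0` otherwise. -/
noncomputable def cmpt (k : Type) [Field k] {Q : Type} (S : Set Q) (q : Q) : Submodule k k :=
  haveI := Classical.dec (q ∈ S)
  if q ∈ S then ⊤ else ⊥

/-- The structure map of the indicator module `k[S]` for `q ≤ q'`: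
the identity of `k` when `q, q' ∈ S`, and `0` otherwise. -/
noncomputable def stMap (k : Type) [Field k] {Q : Type} [PartialOrder Q] (S : Set Q)
    {q q' : Q} (h : q ≤ q') : ↥(cmpt k S q) →ₗ[k] ↥(cmpt k S q') :=
  haveI := Classical.dec (q ∈ S ∧ q' ∈ S)
  if hq : q ∈ S ∧ q' ∈ S then
    Submodule.inclusion (by simp [cmpt, hq.1, hq.2])
  else 0

/-- The space of `Q`-module homomorphisms `k[S] → k[T]` between indicator modules:
families of linear maps in each degree commuting with the structure maps. -/
noncomputable def HomQ (k : Type) [Field k] {Q : Type} [PartialOrder Q] (S T : Set Q) :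
    Submodule k (∀ q : Q, ↥(cmpt k S q) →ₗ[k] ↥(cmpt k T q)) where
  carrier := {φ | ∀ (q q' : Q) (h : q ≤ q'), stMap k T h ∘ₗ φ q = φ q' ∘ₗ stMap k S h}
  add_mem' := by
    intro a b ha hb
    simp only [Set.mem_setOf_eq] at ha hb ⊢
    intro q q' h
    ext x
    have ha' := congrArg (fun g => g x) (ha q q' h)
    have hb' := congrArg (fun g => g x) (hb q q' h)
    simp only [LinearMap.comp_apply] at ha' hb' ⊢
    simp only [Pi.add_apply, LinearMap.add_apply, map_add, ha', hb']
  zero_mem' := by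
    simp only [Set.mem_setOf_eq]
    intro q q' h
    ext x
    simp
  smul_mem' := by
    intro c a ha
    simp only [Set.mem_setOf_eq] at ha ⊢
    intro q q' h
    ext x
    have ha' := congrArg (fun g => g x) (ha q q' h)
    simp only [LinearMap.comp_apply] at ha' ⊢
    simp only [Pi.smul_apply, LinearMap.smul_apply, map_smul, ha']

/-- The scalar by which a homomorphism of indicator modules acts in degree `q`. -/
noncomputable def scl {k : Type} [Field k] {Q : Type} {S T : Set Q}
    (φ : ∀ q : Q, ↥(cmpt k S q) →ₗ[k] ↥(cmpt k T q)) (q : Q) (hq : q ∈ S) : k :=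
  (φ q ⟨1, by simp [cmpt, hq]⟩ : ↥(cmpt k T q)).1

/-- The set of connected components of a subset `S` of a poset: the quotient of `S`
by the equivalence relation generated by comparability (zigzag paths within `S`). -/
def Pi0 {Q : Type} [PartialOrder Q] (S : Set Q) : Type :=
  Quot (fun a b : S => (a : Q) ≤ (b : Q))

section Indicator

variable {k : Type} [Field k] {Q : Type} {S T : Set Q}

lemma mem_cmpt_iff {q : Q} {x : k} : x ∈ cmpt k S q ↔ q ∈ S ∨ x = 0 := by
  by_cases hq : q ∈ S <;> simp [cmpt, hq]

lemma coe_eq_zero_of_notMem {q : Q} (hq : q ∉ S) (x : cmpt k S q) : (x : k) = 0 :=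
  (mem_cmpt_iff.mp x.2).resolve_left hq

/-- A map out of an indicator module is determined in each degree of its support by a scalar. -/
lemma coe_apply_eq_mul_scl (φ : ∀ q : Q, cmpt k S q →ₗ[k] cmpt k T q) {q : Q} (hq : q ∈ S)
    (x : cmpt k S q) : (φ q x : k) = x * scl φ q hq := by
  have hx : x = (x : k) • (⟨1, mem_cmpt_iff.mpr (.inl hq)⟩ : cmpt k S q) :=
    Subtype.ext (by simp)
  conv_lhs => rw [hx, map_smul]
  rfl

/-- The maps `k[S] → k[T]` which are the identity of `k` in the degrees of `S ∩ T`
and zero elsewhere. -/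
noncomputable def indicatorMap (k : Type) [Field k] (S T : Set Q) (q : Q) :
    cmpt k S q →ₗ[k] cmpt k T q :=
  haveI := Classical.dec (q ∈ T)
  if hq : q ∈ T then
    Submodule.inclusion fun _ _ => mem_cmpt_iff.mpr (.inl hq)
  else 0

lemma coe_indicatorMap_of_mem {q : Q} (hq : q ∈ T) (x : cmpt k S q) :
    (indicatorMap k S T q x : k) = x := by
  simp [indicatorMap, hq]

variable [PartialOrder Q]

lemma coe_stMap_of_mem {q q' : Q} (h : q ≤ q') (hq : q ∈ S) (hq' : q' ∈ S) (x : cmpt k S q) :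
    (stMap k S h x : k) = x := by
  simp [stMap, hq, hq']

lemma scl_eq_of_le {φ : ∀ q : Q, cmpt k S q →ₗ[k] cmpt k T q} (hφ : φ ∈ HomQ k S T)
    {q q' : Q} (h : q ≤ q') (hS : q ∈ S) (hS' : q' ∈ S) (hT : q ∈ T) (hT' : q' ∈ T) :
    scl φ q hS = scl φ q' hS' := by
  have key := congrArg Subtype.val
    (LinearMap.congr_fun (hφ q q' h) ⟨1, mem_cmpt_iff.mpr (.inl hS)⟩)
  simpa [coe_stMap_of_mem h hT hT', coe_apply_eq_mul_scl φ hS, coe_apply_eq_mul_scl φ hS',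
    coe_stMap_of_mem h hS hS'] using key

lemma indicatorMap_mem_HomQ (hS : IsUpperSet S) (hT : IsLowerSet T) :
    indicatorMap k S T ∈ HomQ k S T := by
  intro q q' h
  ext x
  simp only [LinearMap.comp_apply]
  by_cases hT' : q' ∈ T
  · have hqT := hT h hT'
    rw [coe_stMap_of_mem h hqT hT', coe_indicatorMap_of_mem hqT, coe_indicatorMap_of_mem hT']
    by_cases hqS : q ∈ S
    · rw [coe_stMap_of_mem h hqS (hS h hqS)]
    · have hx : x = 0 := Subtype.ext (coe_eq_zero_of_notMem hqS x)
      simp [hx]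
  · rw [coe_eq_zero_of_notMem hT', coe_eq_zero_of_notMem hT']

end Indicator

/-- Let `U` be an upset and `D` a downset of a poset `Q` with
`U ∩ D ≠ ∅`.  If every pair of elements of `U` has a lower bound in `U`, or every pair of
elements of `D` has an upper bound in `D`, then `Hom_Q(k[U], k[D])` is a one-dimensional
`k`-vector space. -/
theorem hom_upset_downset_one_dimensional (k : Type) [Field k] (Q : Type) [PartialOrder Q]
    (U D : Set Q) (hU : IsUpperSet U) (hD : IsLowerSet D)
    (hne : (U ∩ D).Nonempty)
    (hconn : (∀ a ∈ U, ∀ b ∈ U, ∃ c ∈ U, c ≤ a ∧ c ≤ b) ∨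
             (∀ a ∈ D, ∀ b ∈ D, ∃ c ∈ D, a ≤ c ∧ b ≤ c)) :
    Module.rank k ↥(HomQ k U D) = 1 := by
  obtain ⟨p, hpU, hpD⟩ := hne
  refine rank_eq_one (⟨indicatorMap k U D, indicatorMap_mem_HomQ hU hD⟩ : HomQ k U D) ?_ ?_
  · intro h
    have h1 := congrArg (fun φ : HomQ k U D => scl φ.1 p hpU) h
    simp [scl, coe_indicatorMap_of_mem hpD] at h1
  · rintro ⟨φ, hφ⟩
    refine ⟨scl φ p hpU, Subtype.ext (funext fun q => LinearMap.ext fun x => Subtype.ext ?_)⟩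
    change scl φ p hpU * (indicatorMap k U D q x : k) = φ q x
    by_cases hqD : q ∈ D
    · rw [coe_indicatorMap_of_mem hqD]
      by_cases hqU : q ∈ U
      · have hscl : scl φ p hpU = scl φ q hqU := by
          rcases hconn with hconn | hconn
          · obtain ⟨c, hcU, hcp, hcq⟩ := hconn p hpU q hqU
            have hcD := hD hcp hpD
            exact (scl_eq_of_le hφ hcp hcU hpU hcD hpD).symm.trans
              (scl_eq_of_le hφ hcq hcU hqU hcD hqD)
          · obtain ⟨c, hcD, hpc, hqc⟩ := hconn p hpD q hqD
            have hcU := hU hpc hpU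
            exact (scl_eq_of_le hφ hpc hpU hcU hpD hcD).trans
              (scl_eq_of_le hφ hqc hqU hcU hqD hcD).symm
        rw [coe_apply_eq_mul_scl φ hqU, hscl, mul_comm]
      · have hx : x = 0 := Subtype.ext (coe_eq_zero_of_notMem hqU x)
        simp [hx]
    · simp [coe_eq_zero_of_notMem hqD]
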